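/- Let γ : ℝ/ℤ → Q be a continuous injective map with image Γ, and let R(x,y) = (1−y, x). Assume: (i) F(Γ) = Γ and Γ ∩ 𝒞 = ∅; (ii) R(Γ) = Γ; (iii) there exist coprime integers p ≥ 0 and q ≥ 1 such that F(γ(x)) = γ(x + p/q) for all x ∈ ℝ/ℤ (i.e. the restriction of F to Γ is conjugate via γ to the rotation by p/q, so F|_Γ is periodic with rotation number p/q); (iv) for each i ∈ {1,2,3,4}, Γ meets the break segment [Eᵢ, Pᵢ] = ℬᵢ ∩ 𝒜ᵢ in exactly one point, denoted Uᵢ, and meets the break segment [Eᵢ₊₁, Pᵢ] = 𝒜ᵢ ∩ ℬᵢ₊₁ in exactly one point, denoted Vᵢ. Then for every i ∈ {1,2,3,4} there exist j ∈ {1,2,3,4} and an integer n ≥ 1 with F^n(Uᵢ) = Vⱼ, and for every j ∈ {1,2,3,4} there exist i ∈ {1,2,3,4} and an integer n ≥ 1 with F^n(Vⱼ) = Uᵢ. -/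

import Mathlib

open Real Set Filter

noncomputable section

/-- A point in the plane. -/
abbrev Pt : Type := ℝ × ℝ

/-- The unit square `Q = [0,1] × [0,1]`. -/
def unitSq : Set Pt := Icc (0:ℝ) 1 ×ˢ Icc (0:ℝ) 1

/-- The corners `E₁, E₂, E₃, E₄` of the unit square (cyclically indexed). -/
def Ept : Fin 4 → Pt := ![(0,0), (1,0), (1,1), (0,1)]

/-- The inner points `P₁, P₂, P₃, P₄` (cyclically indexed). -/
def Ppt (s t : ℝ) : Fin 4 → Pt := ![(s,t), (1-t,s), (1-s,1-t), (t,1-s)]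

/-- The image points `P₁′, P₂′, P₃′, P₄′` (cyclically indexed). -/
def Ppt' (s t : ℝ) : Fin 4 → Pt := ![(1-s,t), (1-t,1-s), (s,1-t), (t,s)]

/-- The triangle `𝒜ᵢ = conv {Eᵢ, Eᵢ₊₁, Pᵢ}`. -/
def Apiece (s t : ℝ) (i : Fin 4) : Set Pt :=
  convexHull ℝ {Ept i, Ept (i+1), Ppt s t i}

/-- The triangle `ℬᵢ = conv {Eᵢ, Pᵢ, Pᵢ₋₁}`. -/
def Bpiece (s t : ℝ) (i : Fin 4) : Set Pt :=
  convexHull ℝ {Ept i, Ppt s t i, Ppt s t (i-1)}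

/-- The central square `𝒞 = conv {P₁, P₂, P₃, P₄}`. -/
def Cpiece (s t : ℝ) : Set Pt :=
  convexHull ℝ {Ppt s t 0, Ppt s t 1, Ppt s t 2, Ppt s t 3}

/-- `F : Q → Q` is continuous, affine on each of the nine pieces, fixes the
corners `Eᵢ` and maps `Pᵢ` to `Pᵢ′`. -/
def IsPAMap (s t : ℝ) (F : Pt → Pt) : Prop :=
  MapsTo F unitSq unitSq ∧
  ContinuousOn F unitSq ∧
  (∀ i : Fin 4, ∃ g : Pt →ᵃ[ℝ] Pt, EqOn F g (Apiece s t i)) ∧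
  (∀ i : Fin 4, ∃ g : Pt →ᵃ[ℝ] Pt, EqOn F g (Bpiece s t i)) ∧
  (∃ g : Pt →ᵃ[ℝ] Pt, EqOn F g (Cpiece s t)) ∧
  (∀ i : Fin 4, F (Ept i) = Ept i) ∧
  (∀ i : Fin 4, F (Ppt s t i) = Ppt' s t i)

/-- The rotation by `π/2` about `Z = (1/2, 1/2)`. -/
def Rmap : Pt → Pt := fun p => (1 - p.2, p.1)

/-- The four coordinates `x, y, 1 - x, 1 - y`, cyclically permuted by the quarter turn. -/
def cycCoord (i : Fin 4) (p : Pt) : ℝ := ![p.1, p.2, 1 - p.1, 1 - p.2] i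

/-- The affine form vanishing on the line through `Eᵢ`, `Pᵢ` and `Pᵢ₊₁`. -/
def sideForm (c σ : ℝ) (i : Fin 4) (p : Pt) : ℝ :=
  c * cycCoord (i + 1) p - σ * cycCoord i p

/-- The affine form vanishing on the line through `Eᵢ₊₁` and `Pᵢ`. -/
def cutForm (c σ : ℝ) (i : Fin 4) (p : Pt) : ℝ :=
  σ ^ 2 * (1 - cycCoord i p) - (1 - σ * c) * cycCoord (i + 1) p

/-- Inequalities describing `𝒜ᵢ` inside the unit square. -/
def regionA (c σ : ℝ) (i : Fin 4) : Set Pt :=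
  {p | sideForm c σ i p ≤ 0 ∧ 0 ≤ cutForm c σ i p}

/-- Inequalities describing `ℬᵢ₊₁` inside the unit square. -/
def regionB (c σ : ℝ) (i : Fin 4) : Set Pt :=
  {p | sideForm c σ i p ≤ 0 ∧ cutForm c σ i p ≤ 0 ∧ 0 ≤ sideForm c σ (i + 1) p}

/-- Twice the signed area of the triangle `z, x, y`. -/
def crossAt (z x y : Pt) : ℝ :=
  (x.1 - z.1) * (y.2 - z.2) - (x.2 - z.2) * (y.1 - z.1)

theorem Fin.eq_add_of_four (i j : Fin 4) :
    j = i ∨ j = i + 1 ∨ j = i + 1 + 1 ∨ j = i + 1 + 1 + 1 := by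
  revert i j
  decide

theorem cycCoord_add_two (i : Fin 4) (p : Pt) :
    cycCoord (i + 1 + 1) p = 1 - cycCoord i p := by
  fin_cases i <;> simp [cycCoord]

theorem cycCoord_nonneg {p : Pt} (hp : p ∈ unitSq) (i : Fin 4) : 0 ≤ cycCoord i p := by
  obtain ⟨⟨h1, h2⟩, h3, h4⟩ := hp
  fin_cases i <;> simp [cycCoord] <;> linarith

theorem cycCoord_ext (i : Fin 4) {p r : Pt} (h : cycCoord i p = cycCoord i r)
    (h' : cycCoord (i + 1) p = cycCoord (i + 1) r) : p = r := by
  fin_cases i <;> simp [cycCoord] at h h' <;> exact Prod.ext (by linarith) (by linarith)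

theorem continuous_cycCoord (i : Fin 4) : Continuous (cycCoord i) := by
  unfold cycCoord
  fin_cases i <;> simp <;> fun_prop

theorem continuous_sideForm (c σ : ℝ) (i : Fin 4) : Continuous (sideForm c σ i) := by
  unfold sideForm
  have := continuous_cycCoord i
  have := continuous_cycCoord (i + 1)
  fun_prop

theorem continuous_cutForm (c σ : ℝ) (i : Fin 4) : Continuous (cutForm c σ i) := by
  unfold cutForm
  have := continuous_cycCoord i
  have := continuous_cycCoord (i + 1)
  fun_prop

theorem cycCoord_comb (i : Fin 4) {α β δ : ℝ} (h : α + β + δ = 1) (x y z : Pt) :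
    cycCoord i (α • x + β • y + δ • z) =
      α * cycCoord i x + β * cycCoord i y + δ * cycCoord i z := by
  obtain rfl : α = 1 - β - δ := by linarith
  fin_cases i <;> simp [cycCoord] <;> ring

theorem crossAt_eq (i : Fin 4) (z x y : Pt) :
    crossAt z x y =
      (cycCoord i x - cycCoord i z) * (cycCoord (i + 1) y - cycCoord (i + 1) z) -
      (cycCoord (i + 1) x - cycCoord (i + 1) z) * (cycCoord i y - cycCoord i z) := by
  fin_cases i <;> simp [cycCoord, crossAt] <;> ring

theorem cycCoord_Ept (i : Fin 4) : cycCoord i (Ept i) = 0 := by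
  fin_cases i <;> simp [cycCoord, Ept]

theorem cycCoord_succ_Ept (i : Fin 4) : cycCoord (i + 1) (Ept i) = 0 := by
  fin_cases i <;> simp [cycCoord, Ept]

theorem cycCoord_Ept_succ (i : Fin 4) : cycCoord i (Ept (i + 1)) = 1 := by
  fin_cases i <;> simp [cycCoord, Ept]

theorem cycCoord_Ppt (s t : ℝ) (i : Fin 4) : cycCoord i (Ppt s t i) = s := by
  fin_cases i <;> simp [cycCoord, Ppt]

theorem cycCoord_succ_Ppt (s t : ℝ) (i : Fin 4) : cycCoord (i + 1) (Ppt s t i) = t := by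
  fin_cases i <;> simp [cycCoord, Ppt]

theorem cycCoord_Ppt_succ (s t : ℝ) (i : Fin 4) :
    cycCoord i (Ppt s t (i + 1)) = 1 - t := by
  fin_cases i <;> simp [cycCoord, Ppt]

theorem cycCoord_Ppt' (s t : ℝ) (i : Fin 4) : cycCoord i (Ppt' s t i) = 1 - s := by
  fin_cases i <;> simp [cycCoord, Ppt']

theorem cycCoord_succ_Ppt' (s t : ℝ) (i : Fin 4) : cycCoord (i + 1) (Ppt' s t i) = t := by
  fin_cases i <;> simp [cycCoord, Ppt']

theorem cycCoord_Ppt'_succ (s t : ℝ) (i : Fin 4) :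
    cycCoord i (Ppt' s t (i + 1)) = 1 - t := by
  fin_cases i <;> simp [cycCoord, Ppt']

theorem Convex.comb_three_mem {S : Set Pt} (hS : Convex ℝ S) {x y z : Pt}
    (hx : x ∈ S) (hy : y ∈ S) (hz : z ∈ S) {α β δ : ℝ}
    (hα : 0 ≤ α) (hβ : 0 ≤ β) (hδ : 0 ≤ δ) (h : α + β + δ = 1) :
    α • x + β • y + δ • z ∈ S := by
  have := hS.sum_mem (t := Finset.univ) (w := ![α, β, δ]) (z := ![x, y, z])
    (by simp [Fin.forall_fin_succ, hα, hβ, hδ]) (by simpa [Fin.sum_univ_three] using h)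
    (by simp [Fin.forall_fin_succ, hx, hy, hz])
  simpa [Fin.sum_univ_three] using this

theorem map_comb {F : Pt → Pt} {x y z : Pt} {g : Pt →ᵃ[ℝ] Pt}
    (hg : EqOn F g (convexHull ℝ {x, y, z})) {α β δ : ℝ} (h : α + β + δ = 1)
    (hα : 0 ≤ α) (hβ : 0 ≤ β) (hδ : 0 ≤ δ) :
    F (α • x + β • y + δ • z) = α • F x + β • F y + δ • F z := by
  have hx : x ∈ convexHull ℝ {x, y, z} := subset_convexHull ℝ _ (by simp)
  have hy : y ∈ convexHull ℝ {x, y, z} := subset_convexHull ℝ _ (by simp)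
  have hz : z ∈ convexHull ℝ {x, y, z} := subset_convexHull ℝ _ (by simp)
  have hmem : α • x + β • y + δ • z ∈ convexHull ℝ {x, y, z} :=
    (convex_convexHull ℝ _).comb_three_mem hx hy hz hα hβ hδ h
  rw [hg hmem, hg hx, hg hy, hg hz, AffineMap.decomp g]
  obtain rfl : α = 1 - β - δ := by linarith
  simp only [Pi.add_apply, map_add, map_smul]
  module

/-- Barycentric coordinates of a point of `𝒜ᵢ`. -/
theorem exists_comb_regionA {c σ : ℝ} (hσ : 0 < σ)
    (i : Fin 4) {p : Pt} (hp : p ∈ unitSq) (hA : p ∈ regionA c σ i) :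
    ∃ α β δ : ℝ, α = cutForm c σ i p / σ ^ 2 ∧ β = -sideForm c σ i p / σ ∧
      0 ≤ α ∧ 0 ≤ β ∧ 0 ≤ δ ∧ α + β + δ = 1 ∧
      p = α • Ept i + β • Ept (i + 1) + δ • Ppt (σ * c) (σ ^ 2) i := by
  obtain ⟨h1, h2⟩ := hA
  have hb := cycCoord_nonneg hp (i + 1)
  have hsum : cutForm c σ i p / σ ^ 2 + -sideForm c σ i p / σ + cycCoord (i + 1) p / σ ^ 2
      = 1 := by
    unfold cutForm sideForm
    field_simp
    ring
  refine ⟨_, _, cycCoord (i + 1) p / σ ^ 2, rfl, rfl, by positivity,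
    div_nonneg (by linarith) hσ.le, by positivity, hsum, ?_⟩
  apply cycCoord_ext i <;> rw [cycCoord_comb _ hsum]
  · rw [cycCoord_Ept, cycCoord_Ept_succ, cycCoord_Ppt]
    unfold sideForm
    field_simp
    ring
  · rw [cycCoord_succ_Ept, cycCoord_Ept, cycCoord_succ_Ppt]
    field_simp
    ring

/-- Barycentric coordinates of a point of `ℬᵢ₊₁`. -/
theorem exists_comb_regionB {c σ : ℝ} (hcσ : c ^ 2 + σ ^ 2 = 1) (hσ : 0 < σ) (hlt : σ < c)
    (i : Fin 4) {p : Pt} (hB : p ∈ regionB c σ i) :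
    ∃ α β δ : ℝ, β = -cutForm c σ i p / (σ * (c - σ)) ∧
      δ = sideForm c σ (i + 1) p / (c - σ) ∧
      0 ≤ α ∧ 0 ≤ β ∧ 0 ≤ δ ∧ α + β + δ = 1 ∧
      p = α • Ept (i + 1) + β • Ppt (σ * c) (σ ^ 2) (i + 1) + δ • Ppt (σ * c) (σ ^ 2) i := by
  obtain ⟨h1, h2, h3⟩ := hB
  have hd : 0 < c - σ := by linarith
  have hsum : -sideForm c σ i p / σ + -cutForm c σ i p / (σ * (c - σ)) +
      sideForm c σ (i + 1) p / (c - σ) = 1 := by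
    unfold cutForm sideForm
    rw [cycCoord_add_two]
    field_simp
    linear_combination (-cycCoord (i + 1) p) * hcσ
  refine ⟨_, _, _, rfl, rfl, div_nonneg (by linarith) hσ.le,
    div_nonneg (by linarith) (by positivity), by positivity, hsum, ?_⟩
  apply cycCoord_ext i <;> rw [cycCoord_comb _ hsum]
  · rw [cycCoord_Ept_succ, cycCoord_Ppt_succ, cycCoord_Ppt]
    unfold cutForm sideForm
    rw [cycCoord_add_two]
    field_simp
    linear_combination (cycCoord i p * σ ^ 2 - σ ^ 2 + cycCoord (i + 1) p) * hcσ
  · rw [cycCoord_Ept, cycCoord_Ppt, cycCoord_succ_Ppt]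
    unfold cutForm sideForm
    rw [cycCoord_add_two]
    field_simp
    linear_combination (cycCoord (i + 1) p * σ ^ 2) * hcσ

theorem sideForm_add_two (c σ : ℝ) (i : Fin 4) (p : Pt) :
    sideForm c σ (i + 1 + 1) p = c - σ - sideForm c σ i p := by
  unfold sideForm
  rw [cycCoord_add_two, cycCoord_add_two]
  ring

theorem Ppt_mem_Cpiece (s t : ℝ) (i : Fin 4) : Ppt s t i ∈ Cpiece s t := by
  apply subset_convexHull
  fin_cases i <;> simp

theorem mem_Cpiece {c σ : ℝ} (hcσ : c ^ 2 + σ ^ 2 = 1) (hlt : σ < c) {p : Pt}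
    (h : ∀ i, 0 ≤ sideForm c σ i p) : p ∈ Cpiece (σ * c) (σ ^ 2) := by
  have hd : 0 < c - σ := by linarith
  have hC := Ppt_mem_Cpiece (σ * c) (σ ^ 2)
  have hconv : Convex ℝ (Cpiece (σ * c) (σ ^ 2)) := convex_convexHull ℝ _
  obtain ⟨l, hl⟩ : ∃ l, l = sideForm c σ 0 p / (c - σ) := ⟨_, rfl⟩
  obtain ⟨m, hm⟩ : ∃ m, m = sideForm c σ 1 p / (c - σ) := ⟨_, rfl⟩
  have h0 := h 0
  have h1 := h 1
  have h2 : 0 ≤ c - σ - sideForm c σ 0 p := sideForm_add_two c σ 0 p ▸ h 2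
  have h3 : 0 ≤ c - σ - sideForm c σ 1 p := sideForm_add_two c σ 1 p ▸ h 3
  have hl0 : 0 ≤ l := hl ▸ by positivity
  have hm0 : 0 ≤ m := hm ▸ by positivity
  have hl1 : 0 ≤ 1 - l := by
    rw [hl, sub_nonneg, div_le_one hd]; linarith
  have hm1 : 0 ≤ 1 - m := by
    rw [hm, sub_nonneg, div_le_one hd]; linarith
  have key := hconv (hconv (hC 0) (hC 1) hm0 hm1 (by ring))
    (hconv (hC 3) (hC 2) hm0 hm1 (by ring)) hl1 hl0 (by ring)
  convert key using 1
  simp only [sideForm, cycCoord] at hl hm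
  simp at hl hm
  have hl' : l * (c - σ) = c * p.2 - σ * p.1 := by rw [hl]; field_simp
  have hm' : m * (c - σ) = c * (1 - p.1) - σ * p.2 := by rw [hm]; field_simp
  ext
  · simp [Ppt]
    linear_combination (1 - m - p.1) * hcσ + σ * hl' + c * hm'
  · simp [Ppt]
    linear_combination (l - p.2) * hcσ - c * hl' + σ * hm'

theorem exists_coord_regionA {c σ : ℝ} (hσ : 0 < σ) {F : Pt → Pt}
    (hF : IsPAMap (σ * c) (σ ^ 2) F)
    (i : Fin 4) {p : Pt} (hp : p ∈ unitSq) (hA : p ∈ regionA c σ i) :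
    ∃ α β δ : ℝ, α = cutForm c σ i p / σ ^ 2 ∧ β = -sideForm c σ i p / σ ∧
      α + β + δ = 1 ∧
      cycCoord i p = β + δ * (σ * c) ∧ cycCoord (i + 1) p = δ * σ ^ 2 ∧
      cycCoord i (F p) = β + δ * (1 - σ * c) ∧ cycCoord (i + 1) (F p) = δ * σ ^ 2 := by
  obtain ⟨α, β, δ, hα, hβ, hα0, hβ0, hδ0, hsum, hpe⟩ := exists_comb_regionA hσ i hp hA
  obtain ⟨-, -, hFA, -, -, hFE, hFP⟩ := hF
  obtain ⟨g, hg⟩ := hFA i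
  have hFp := map_comb hg hsum hα0 hβ0 hδ0
  rw [← hpe, hFE, hFE, hFP] at hFp
  refine ⟨α, β, δ, hα, hβ, hsum, ?_, ?_, ?_, ?_⟩
  · rw [hpe, cycCoord_comb _ hsum, cycCoord_Ept, cycCoord_Ept_succ, cycCoord_Ppt]; ring
  · rw [hpe, cycCoord_comb _ hsum, cycCoord_succ_Ept, cycCoord_Ept, cycCoord_succ_Ppt]; ring
  · rw [hFp, cycCoord_comb _ hsum, cycCoord_Ept, cycCoord_Ept_succ, cycCoord_Ppt']; ring
  · rw [hFp, cycCoord_comb _ hsum, cycCoord_succ_Ept, cycCoord_Ept, cycCoord_succ_Ppt']; ring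

theorem exists_coord_regionB {c σ : ℝ} (hcσ : c ^ 2 + σ ^ 2 = 1) (hσ : 0 < σ) (hlt : σ < c)
    {F : Pt → Pt} (hF : IsPAMap (σ * c) (σ ^ 2) F)
    (i : Fin 4) {p : Pt} (hB : p ∈ regionB c σ i) :
    ∃ β δ : ℝ, β = -cutForm c σ i p / (σ * (c - σ)) ∧
      δ = sideForm c σ (i + 1) p / (c - σ) ∧
      cycCoord i p = 1 - β * σ ^ 2 - δ * (1 - σ * c) ∧
      cycCoord (i + 1) p = β * (σ * c) + δ * σ ^ 2 ∧
      cycCoord i (F p) = 1 - β * σ ^ 2 - δ * (σ * c) ∧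
      cycCoord (i + 1) (F p) = β * (1 - σ * c) + δ * σ ^ 2 := by
  obtain ⟨α, β, δ, hβ, hδ, hα0, hβ0, hδ0, hsum, hpe⟩ := exists_comb_regionB hcσ hσ hlt i hB
  obtain ⟨-, -, -, hFB, -, hFE, hFP⟩ := hF
  obtain ⟨g, hg⟩ := hFB (i + 1)
  rw [Bpiece, add_sub_cancel_right] at hg
  have hFp := map_comb hg hsum hα0 hβ0 hδ0
  rw [← hpe, hFE, hFP, hFP] at hFp
  refine ⟨β, δ, hβ, hδ, ?_, ?_, ?_, ?_⟩
  · rw [hpe, cycCoord_comb _ hsum, cycCoord_Ept_succ, cycCoord_Ppt_succ, cycCoord_Ppt]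
    linear_combination hsum
  · rw [hpe, cycCoord_comb _ hsum, cycCoord_Ept, cycCoord_Ppt, cycCoord_succ_Ppt]; ring
  · rw [hFp, cycCoord_comb _ hsum, cycCoord_Ept_succ, cycCoord_Ppt'_succ, cycCoord_Ppt']
    linear_combination hsum
  · rw [hFp, cycCoord_comb _ hsum, cycCoord_Ept, cycCoord_Ppt', cycCoord_succ_Ppt']; ring

theorem crossAt_map_regionA {c σ : ℝ} (hσ : 0 < σ) {F : Pt → Pt}
    (hF : IsPAMap (σ * c) (σ ^ 2) F) (i : Fin 4) {x y z : Pt}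
    (hx : x ∈ unitSq) (hy : y ∈ unitSq) (hz : z ∈ unitSq)
    (hxA : x ∈ regionA c σ i) (hyA : y ∈ regionA c σ i) (hzA : z ∈ regionA c σ i) :
    crossAt (F z) (F x) (F y) = crossAt z x y := by
  obtain ⟨_, _, _, -, -, -, hx1, hx2, hx3, hx4⟩ := exists_coord_regionA hσ hF i hx hxA
  obtain ⟨_, _, _, -, -, -, hy1, hy2, hy3, hy4⟩ := exists_coord_regionA hσ hF i hy hyA
  obtain ⟨_, _, _, -, -, -, hz1, hz2, hz3, hz4⟩ := exists_coord_regionA hσ hF i hz hzA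
  rw [crossAt_eq i, crossAt_eq i, hx1, hx2, hx3, hx4, hy1, hy2, hy3, hy4, hz1, hz2, hz3, hz4]
  ring

theorem crossAt_map_regionB {c σ : ℝ} (hcσ : c ^ 2 + σ ^ 2 = 1) (hσ : 0 < σ) (hlt : σ < c)
    {F : Pt → Pt} (hF : IsPAMap (σ * c) (σ ^ 2) F) (i : Fin 4) {x y z : Pt}
    (hx : x ∈ regionB c σ i) (hy : y ∈ regionB c σ i) (hz : z ∈ regionB c σ i) :
    crossAt (F z) (F x) (F y) = crossAt z x y := by
  obtain ⟨_, _, -, -, hx1, hx2, hx3, hx4⟩ := exists_coord_regionB hcσ hσ hlt hF i hx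
  obtain ⟨_, _, -, -, hy1, hy2, hy3, hy4⟩ := exists_coord_regionB hcσ hσ hlt hF i hy
  obtain ⟨_, _, -, -, hz1, hz2, hz3, hz4⟩ := exists_coord_regionB hcσ hσ hlt hF i hz
  rw [crossAt_eq i, crossAt_eq i, hx1, hx2, hx3, hx4, hy1, hy2, hy3, hy4, hz1, hz2, hz3, hz4]
  ring

/-- `F` strictly increases the signed area when the segment `[Eᵢ₊₁, Pᵢ₊₁]` is crossed from
`ℬᵢ₊₁` to `𝒜ᵢ₊₁`. -/
theorem crossAt_lt_of_side {c σ : ℝ} (hcσ : c ^ 2 + σ ^ 2 = 1) (hσ : 0 < σ) (hlt : σ < c)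
    {F : Pt → Pt} (hF : IsPAMap (σ * c) (σ ^ 2) F) (i : Fin 4) {x y z : Pt}
    (hy : y ∈ unitSq) (hz : z ∈ unitSq)
    (hxB : x ∈ regionB c σ i) (hyA : y ∈ regionA c σ (i + 1)) (hzA : z ∈ regionA c σ (i + 1))
    (hx0 : sideForm c σ (i + 1) x ≠ 0) (hy0 : sideForm c σ (i + 1) y ≠ 0)
    (hz0 : sideForm c σ (i + 1) z = 0) :
    crossAt z x y < crossAt (F z) (F x) (F y) := by
  obtain ⟨β, δ, -, hδ, hx1, hx2, hx3, hx4⟩ := exists_coord_regionB hcσ hσ hlt hF i hxB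
  obtain ⟨_, η, _, -, hη, -, hy1, hy2, hy3, hy4⟩ := exists_coord_regionA hσ hF (i + 1) hy hyA
  obtain ⟨_, ζ, _, -, hζ, -, hz1, hz2, hz3, hz4⟩ := exists_coord_regionA hσ hF (i + 1) hz hzA
  have hδ0 : 0 < δ := hδ ▸ div_pos (lt_of_le_of_ne hxB.2.2 hx0.symm) (by linarith)
  have hη0 : 0 < η := hη ▸ div_pos (neg_pos.2 (lt_of_le_of_ne hyA.1 hy0)) hσ
  have hζ0 : ζ = 0 := by rw [hζ, hz0]; simp
  have hpos : 0 < δ * η * (c - σ) ^ 2 := by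
    have : 0 < c - σ := by linarith
    positivity
  rw [← sub_pos]
  convert hpos using 1
  rw [crossAt_eq (i + 1), crossAt_eq (i + 1), cycCoord_add_two i x, cycCoord_add_two i (F x),
    hx1, hx2, hx3, hx4, hy1, hy2, hy3, hy4, hz1, hz2, hz3, hz4, hζ0]
  linear_combination (-δ * η) * hcσ

/-- `F` strictly decreases the signed area when the segment `[Eᵢ₊₁, Pᵢ]` is crossed from
`𝒜ᵢ` to `ℬᵢ₊₁`. -/
theorem crossAt_lt_of_cut {c σ : ℝ} (hcσ : c ^ 2 + σ ^ 2 = 1) (hσ : 0 < σ) (hlt : σ < c)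
    {F : Pt → Pt} (hF : IsPAMap (σ * c) (σ ^ 2) F) (i : Fin 4) {x y z : Pt}
    (hx : x ∈ unitSq) (hz : z ∈ unitSq)
    (hxA : x ∈ regionA c σ i) (hyB : y ∈ regionB c σ i) (hzA : z ∈ regionA c σ i)
    (hx0 : cutForm c σ i x ≠ 0) (hy0 : cutForm c σ i y ≠ 0) (hz0 : cutForm c σ i z = 0) :
    crossAt (F z) (F x) (F y) < crossAt z x y := by
  obtain ⟨α, β, δ, hα, -, hsx, hx1, hx2, hx3, hx4⟩ := exists_coord_regionA hσ hF i hx hxA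
  obtain ⟨η, _, hη, -, hy1, hy2, hy3, hy4⟩ := exists_coord_regionB hcσ hσ hlt hF i hyB
  obtain ⟨ξ, ζ, μ, hξ, -, hsz, hz1, hz2, hz3, hz4⟩ := exists_coord_regionA hσ hF i hz hzA
  have hd : 0 < c - σ := by linarith
  have hα0 : 0 < α := hα ▸ div_pos (lt_of_le_of_ne hxA.2 hx0.symm) (by positivity)
  have hη0 : 0 < η :=
    hη ▸ div_pos (neg_pos.2 (lt_of_le_of_ne hyB.2.1 hy0)) (by positivity)
  have hξ0 : ξ = 0 := by rw [hξ, hz0]; simp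
  have hpos : 0 < α * η * (c - σ) ^ 2 := by positivity
  obtain rfl : β = 1 - α - δ := by linarith
  obtain rfl : ζ = 1 - μ := by linarith
  rw [← sub_pos]
  convert hpos using 1
  rw [crossAt_eq i, crossAt_eq i,
    hx1, hx2, hx3, hx4, hy1, hy2, hy3, hy4, hz1, hz2, hz3, hz4]
  linear_combination (-α * η) * hcσ

/-- Points of the line close to `u`, on the side of `u` given by the sign `e`, lie in `G`. -/
def SideGerm (e : ℝ) (G : Set ℝ) (u : ℝ) : Prop :=
  ∀ᶠ ε in nhdsWithin (0 : ℝ) (Ioi 0), u + e * ε ∈ G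

theorem SideGerm.not_compl {e : ℝ} {G : Set ℝ} {u : ℝ} (h : SideGerm e G u) :
    ¬ SideGerm e Gᶜ u := fun h' => by
  obtain ⟨ε, h1, h2⟩ := (Filter.Eventually.and h h').exists
  exact h2 h1

theorem sideGerm_add_int {G : Set ℝ} (hper : ∀ (r : ℝ) (n : ℤ), r + n ∈ G ↔ r ∈ G) (e u : ℝ)
    (n : ℤ) : SideGerm e G (u + n) ↔ SideGerm e G u := by
  unfold SideGerm
  simp_rw [add_right_comm u (n : ℝ), hper]

theorem sideGerm_one_of_Ioo {G : Set ℝ} {u v : ℝ} (h : u < v) (hG : Ioo u v ⊆ G) :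
    SideGerm 1 G u := by
  filter_upwards [Ioo_mem_nhdsGT (sub_pos.2 h)] with ε hε
  exact hG ⟨by linarith [hε.1], by linarith [hε.2]⟩

theorem sideGerm_neg_one_of_Ioo {G : Set ℝ} {u v : ℝ} (h : u < v) (hG : Ioo u v ⊆ G) :
    SideGerm (-1) G v := by
  filter_upwards [Ioo_mem_nhdsGT (sub_pos.2 h)] with ε hε
  exact hG ⟨by linarith [hε.2], by linarith [hε.1]⟩

theorem sideGerm_of_nhds {P : Set ℝ} {u : ℝ} (h : P ∈ nhds u) (e : ℝ) : SideGerm e P u := by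
  have : Filter.Tendsto (fun ε : ℝ => u + e * ε) (nhdsWithin 0 (Ioi 0)) (nhds u) := by
    have : Continuous fun ε : ℝ => u + e * ε := by fun_prop
    simpa using (this.tendsto 0).mono_left nhdsWithin_le_nhds
  exact this h

theorem add_mul_ne_add_int {e ε : ℝ} (he : e = 1 ∨ e = -1) (h0 : 0 < ε) (h1 : ε < 1)
    (w : ℝ) (n : ℤ) : w + e * ε ≠ w + n := by
  intro h
  rcases he with rfl | rfl
  · have a : (0 : ℝ) < n := by linarith
    have b : (n : ℝ) < 1 := by linarith
    norm_cast at a b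
    omega
  · have a : (-1 : ℝ) < n := by linarith
    have b : (n : ℝ) < 0 := by linarith
    norm_cast at a b
    omega

theorem sideGerm_iff_not {e w : ℝ} {G G' : Set ℝ} (he : e = 1 ∨ e = -1)
    (hloc : ∀ᶠ r in nhds w, r ∈ G ∨ r ∈ G') (hint : ∀ r ∈ G, r ∈ G' → ∃ n : ℤ, r = w + n)
    (hdich : SideGerm e G' w ∨ SideGerm e G'ᶜ w) : SideGerm e G' w ↔ ¬ SideGerm e G w := by
  constructor
  · intro h' h
    obtain ⟨ε, ⟨h1, h2⟩, h3⟩ :=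
      ((Filter.Eventually.and h h').and (Ioo_mem_nhdsGT (zero_lt_one' ℝ))).exists
    obtain ⟨n, hn⟩ := hint _ h1 h2
    exact add_mul_ne_add_int he h3.1 h3.2 w n hn
  · intro h
    refine hdich.resolve_right fun hc => h ?_
    filter_upwards [hc, sideGerm_of_nhds hloc e] with ε h1 h2
    exact h2.resolve_right h1

/-- On each of the two sides of `u` the set `G` contains everything or nothing, not everything on
both, and on the two arcs from `u` to `v` modulo one it behaves alike near both ends. -/
structure IsArc (G : Set ℝ) (u v : ℝ) : Prop where
  right_iff : SideGerm 1 G u ↔ SideGerm (-1) G v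
  left_iff : SideGerm (-1) G u ↔ SideGerm 1 G v
  not_both : ¬ (SideGerm 1 G u ∧ SideGerm (-1) G u)
  right_dich : SideGerm 1 G u ∨ SideGerm 1 Gᶜ u
  left_dich : SideGerm (-1) G u ∨ SideGerm (-1) Gᶜ u

/-- A one-periodic closed set whose boundary consists of two points modulo one coincides, on
each of the two arcs between them, with everything or nothing; and not with everything on both. -/
theorem isArc_of_isClosed {G H : Set ℝ} (hG : IsClosed G) (hH : IsClosed H)
    (hcov : ∀ r, r ∈ G ∨ r ∈ H) (hper : ∀ (r : ℝ) (n : ℤ), r + n ∈ G ↔ r ∈ G) {u v : ℝ}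
    (hGH : ∀ r ∈ G, r ∈ H → (∃ n : ℤ, r = u + n) ∨ ∃ n : ℤ, r = v + n)
    (huG : u ∈ G) (hvG : v ∈ G)
    (huv : ∀ n : ℤ, v ≠ u + n) (hne : ∃ r, r ∉ G) :
    IsArc G u v := by
  have hperc : ∀ (r : ℝ) (n : ℤ), r + n ∈ Gᶜ ↔ r ∈ Gᶜ := fun r n => not_congr (hper r n)
  wlog hv : u < v ∧ v < u + 1 generalizing v
  · have h0 : v - ⌊v - u⌋ ≠ u := fun h => huv ⌊v - u⌋ (by linarith)
    have h1 := Int.floor_le (v - u)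
    have h2 := Int.lt_floor_add_one (v - u)
    have key := this (v := v - ⌊v - u⌋) (fun r hr hr' => by
        rcases hGH r hr hr' with h | ⟨n, hn⟩
        · exact Or.inl h
        · exact Or.inr ⟨n + ⌊v - u⌋, by push_cast; linarith⟩)
      (by have := (hper v (-⌊v - u⌋)).2 hvG; push_cast at this; rwa [sub_eq_add_neg])
      (fun n hn => huv (n + ⌊v - u⌋) (by push_cast; linarith))
      ⟨lt_of_le_of_ne (by linarith) h0.symm, by linarith⟩
    have e1 := fun e => sideGerm_add_int hper e v (-⌊v - u⌋)
    push_cast at e1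
    simp only [← sub_eq_add_neg] at e1
    exact ⟨by rw [← e1]; exact key.1, by rw [← e1]; exact key.2, key.3, key.4, key.5⟩
  obtain ⟨hv1, hv2⟩ := hv
  have dich : ∀ a b : ℝ, (∀ r ∈ Ioo a b, ∀ n : ℤ, r ≠ u + n ∧ r ≠ v + n) →
      Ioo a b ⊆ G ∨ Ioo a b ⊆ Gᶜ := by
    intro a b hab
    have hdisj : Ioo a b ∩ (G ∩ H) = ∅ := by
      ext r
      simp only [mem_inter_iff, mem_empty_iff_false, iff_false]
      rintro ⟨hr, h1, h2⟩
      rcases hGH r h1 h2 with ⟨n, hn⟩ | ⟨n, hn⟩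
      · exact (hab r hr n).1 hn
      · exact (hab r hr n).2 hn
    rcases isPreconnected_iff_subset_of_disjoint_closed.1 isPreconnected_Ioo G H hG hH
      (fun r _ => hcov r) hdisj with h | h
    · exact Or.inl h
    · refine Or.inr fun r hr hrG => ?_
      have : r ∈ Ioo a b ∩ (G ∩ H) := ⟨hr, hrG, h hr⟩
      rw [hdisj] at this
      exact this
  have d1 : Ioo u v ⊆ G ∨ Ioo u v ⊆ Gᶜ := dich u v fun r hr n => by
    constructor
    · rintro rfl
      have h1 : (0 : ℝ) < n := by linarith [hr.1]
      have h2 : (n : ℝ) < 1 := by linarith [hr.2]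
      norm_cast at h1 h2
      omega
    · rintro rfl
      have h1 : (-1 : ℝ) < n := by linarith [hr.1]
      have h2 : (n : ℝ) < 0 := by linarith [hr.2]
      norm_cast at h1 h2
      omega
  have d2 : Ioo v (u + 1) ⊆ G ∨ Ioo v (u + 1) ⊆ Gᶜ := dich v (u + 1) fun r hr n => by
    constructor
    · rintro rfl
      have h1 : (0 : ℝ) < n := by linarith [hr.1]
      have h2 : (n : ℝ) < 1 := by linarith [hr.2]
      norm_cast at h1 h2
      omega
    · rintro rfl
      have h1 : (0 : ℝ) < n := by linarith [hr.1]
      have h2 : (n : ℝ) < 1 := by linarith [hr.2]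
      norm_cast at h1 h2
      omega
  have hup := sideGerm_add_int hper (-1) u 1
  have hupc := sideGerm_add_int hperc (-1) u 1
  push_cast at hup hupc
  have a1 : ∀ {K : Set ℝ}, Ioo u v ⊆ K → SideGerm 1 K u := sideGerm_one_of_Ioo hv1
  have a2 : ∀ {K : Set ℝ}, Ioo u v ⊆ K → SideGerm (-1) K v := sideGerm_neg_one_of_Ioo hv1
  have b1 : ∀ {K : Set ℝ}, Ioo v (u + 1) ⊆ K → SideGerm 1 K v := sideGerm_one_of_Ioo hv2
  have b2 : ∀ {K : Set ℝ}, Ioo v (u + 1) ⊆ K → SideGerm (-1) K (u + 1) :=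
    sideGerm_neg_one_of_Ioo hv2
  refine ⟨?_, ?_, ?_, d1.imp a1 a1, d2.imp (hup.1 <| b2 ·) (hupc.1 <| b2 ·)⟩
  · rcases d1 with d | d
    · exact ⟨fun _ => a2 d, fun _ => a1 d⟩
    · exact ⟨fun h => (h.not_compl (a1 d)).elim, fun h => (h.not_compl (a2 d)).elim⟩
  · rcases d2 with d | d
    · exact ⟨fun _ => b1 d, fun _ => hup.1 (b2 d)⟩
    · exact ⟨fun h => (h.not_compl (hupc.1 (b2 d))).elim, fun h => (h.not_compl (b1 d)).elim⟩
  · rintro ⟨h1, h2⟩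
    have c1 : Ioo u v ⊆ G := d1.resolve_right fun d => h1.not_compl (a1 d)
    have c2 : Ioo v (u + 1) ⊆ G := d2.resolve_right fun d => h2.not_compl (hupc.1 (b2 d))
    obtain ⟨r, hr⟩ := hne
    apply hr
    rw [← hper r (-⌊r - u⌋)]
    have f1 := Int.floor_le (r - u)
    have f2 := Int.lt_floor_add_one (r - u)
    push_cast
    generalize hx : r + -(⌊r - u⌋ : ℝ) = x
    have x1 : u ≤ x := by linarith
    have x2 : x < u + 1 := by linarith
    rcases x1.eq_or_lt with rfl | x1
    · exact huG
    rcases lt_trichotomy x v with h | rfl | h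
    · exact c1 ⟨x1, h⟩
    · exact hvG
    · exact c2 ⟨h, x2⟩

/-- Along a periodic orbit, a quantity that is nondecreasing off `T` and increases at the
starting point has to meet `T`. -/
theorem exists_mem_of_periodic_increase {a : ℝ → ℝ → ℝ} {ρ : ℝ} {q : ℕ} (hq : 1 ≤ q)
    {r : ℝ} {T : Set ℝ} (hper : ∀ ε, a (r + q * ρ) ε = a r ε)
    (hr : ∀ᶠ ε in nhdsWithin (0 : ℝ) (Ioi 0), a r ε < a (r + ρ) ε)
    (hT : ∀ x ∉ T, ∀ᶠ ε in nhdsWithin (0 : ℝ) (Ioi 0), a x ε ≤ a (x + ρ) ε) :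
    ∃ n : ℕ, 1 ≤ n ∧ r + n * ρ ∈ T := by
  by_contra! hno
  have hall : ∀ᶠ ε in nhdsWithin (0 : ℝ) (Ioi 0), ∀ n ∈ Finset.Icc 1 q,
      a (r + n * ρ) ε ≤ a (r + n * ρ + ρ) ε :=
    (Finset.eventually_all _).2 fun n hn => hT _ (hno n (Finset.mem_Icc.1 hn).1)
  obtain ⟨ε, h0, h⟩ := (hr.and hall).exists
  have key : ∀ n : ℕ, 1 ≤ n → n ≤ q → a r ε < a (r + n * ρ) ε := by
    intro n hn
    induction n, hn using Nat.le_induction with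
    | base => intro _; simpa using h0
    | succ n hn ih =>
      intro hnq
      refine (ih (by omega)).trans_le ?_
      have e : r + ((n + 1 : ℕ) : ℝ) * ρ = r + n * ρ + ρ := by push_cast; ring
      exact e ▸ h n (Finset.mem_Icc.2 ⟨hn, by omega⟩)
  exact (key q hq le_rfl).ne (hper ε).symm

/-- A point of `[Eᵢ, Pⱼ]` other than its ends has positive barycentric coordinates. -/
theorem comb_pos {s t : ℝ} {x : Pt} {i j : Fin 4} (hx : x ∈ segment ℝ (Ept i) (Ppt s t j))
    (hE : x ≠ Ept i) (hC : x ∉ Cpiece s t) :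
    ∃ a b : ℝ, 0 < a ∧ 0 < b ∧ a + b = 1 ∧ x = a • Ept i + b • Ppt s t j + (0 : ℝ) • 0 := by
  obtain ⟨a, b, ha, hb, hab, rfl⟩ := hx
  refine ⟨a, b, ha.lt_of_ne ?_, hb.lt_of_ne ?_, hab, by simp⟩
  · rintro rfl
    obtain rfl : b = 1 := by linarith
    exact hC (by simpa using Ppt_mem_Cpiece s t j)
  · rintro rfl
    obtain rfl : a = 1 := by linarith
    exact hE (by simp)

/-- A lift `g` to the real line of an invariant circle avoiding `𝒞` and the corners, on which `F`
acts as the translation by `ρ`; the circle meets `[Eᵢ, Pᵢ]` exactly at `g (u i)` and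
`[Eᵢ₊₁, Pᵢ]` exactly at `g (v i)`. -/
structure InvariantLift (c σ : ℝ) (F : Pt → Pt) (g : ℝ → Pt) (ρ : ℝ) (u v : Fin 4 → ℝ) :
    Prop where
  sq_add_sq : c ^ 2 + σ ^ 2 = 1
  pos : 0 < σ
  lt : σ < c
  isPAMap : IsPAMap (σ * c) (σ ^ 2) F
  continuous : Continuous g
  eq_iff : ∀ r r', g r = g r' ↔ ∃ n : ℤ, r = r' + n
  mem_unitSq : ∀ r, g r ∈ unitSq
  notMem_Cpiece : ∀ r, g r ∉ Cpiece (σ * c) (σ ^ 2)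
  ne_Ept : ∀ r i, g r ≠ Ept i
  conj : ∀ r, F (g r) = g (r + ρ)
  mem_u : ∀ i, g (u i) ∈ segment ℝ (Ept i) (Ppt (σ * c) (σ ^ 2) i)
  eq_u : ∀ i r, g r ∈ segment ℝ (Ept i) (Ppt (σ * c) (σ ^ 2) i) → g r = g (u i)
  mem_v : ∀ i, g (v i) ∈ segment ℝ (Ept (i + 1)) (Ppt (σ * c) (σ ^ 2) i)
  eq_v : ∀ i r, g r ∈ segment ℝ (Ept (i + 1)) (Ppt (σ * c) (σ ^ 2) i) → g r = g (v i)

namespace InvariantLift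

variable {c σ : ℝ} {F : Pt → Pt} {g : ℝ → Pt} {ρ : ℝ} {u v : Fin 4 → ℝ}

theorem forms_u (h : InvariantLift c σ F g ρ u v) (i : Fin 4) :
    sideForm c σ (i + 1) (g (u (i + 1))) = 0 ∧ sideForm c σ i (g (u (i + 1))) < 0 ∧
    cutForm c σ i (g (u (i + 1))) < 0 ∧ 0 < cutForm c σ (i + 1) (g (u (i + 1))) := by
  obtain ⟨a, b, ha, hb, hab, he⟩ := comb_pos (h.mem_u (i + 1)) (h.ne_Ept _ _) (h.notMem_Cpiece _)
  have hsum : a + b + 0 = 1 := by linarith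
  have h1 := cycCoord_comb i hsum (Ept (i + 1)) (Ppt (σ * c) (σ ^ 2) (i + 1)) 0
  have h2 := cycCoord_comb (i + 1) hsum (Ept (i + 1)) (Ppt (σ * c) (σ ^ 2) (i + 1)) 0
  rw [← he, cycCoord_Ept_succ, cycCoord_Ppt_succ] at h1
  rw [← he, cycCoord_Ept, cycCoord_Ppt] at h2
  have hcσ := h.sq_add_sq
  have hσ := h.pos
  have hd : 0 < c - σ := sub_pos.2 h.lt
  unfold sideForm cutForm
  rw [cycCoord_add_two, h1, h2]
  obtain rfl : a = 1 - b := by linarith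
  refine ⟨by ring, ?_, ?_, ?_⟩
  · have : 0 < σ * (1 - b) := by positivity
    linear_combination this + b * σ * hcσ
  · have : 0 < b * σ * (c - σ) := by positivity
    linear_combination this + b * σ ^ 2 * hcσ
  · have : 0 < σ ^ 2 * (1 - b) := by positivity
    linear_combination this

theorem forms_v (h : InvariantLift c σ F g ρ u v) (i : Fin 4) :
    cutForm c σ i (g (v i)) = 0 ∧ sideForm c σ i (g (v i)) < 0 ∧
    0 < sideForm c σ (i + 1) (g (v i)) := by
  obtain ⟨a, b, ha, hb, hab, he⟩ := comb_pos (h.mem_v i) (h.ne_Ept _ _) (h.notMem_Cpiece _)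
  have hsum : a + b + 0 = 1 := by linarith
  have h1 := cycCoord_comb i hsum (Ept (i + 1)) (Ppt (σ * c) (σ ^ 2) i) 0
  have h2 := cycCoord_comb (i + 1) hsum (Ept (i + 1)) (Ppt (σ * c) (σ ^ 2) i) 0
  rw [← he, cycCoord_Ept_succ, cycCoord_Ppt] at h1
  rw [← he, cycCoord_Ept, cycCoord_succ_Ppt] at h2
  have hcσ := h.sq_add_sq
  have hσ := h.pos
  have hd : 0 < c - σ := sub_pos.2 h.lt
  unfold sideForm cutForm
  rw [cycCoord_add_two, h1, h2]
  obtain rfl : a = 1 - b := by linarith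
  refine ⟨by ring, ?_, ?_⟩
  · have : 0 < σ * (1 - b) := by positivity
    linear_combination this
  · have : 0 < b * (c - σ) := by positivity
    linear_combination this + b * σ * hcσ

theorem eq_u_of_regionA (h : InvariantLift c σ F g ρ u v) {i : Fin 4} {r : ℝ}
    (hA : g r ∈ regionA c σ i) (h0 : sideForm c σ i (g r) = 0) : g r = g (u i) := by
  obtain ⟨α, β, δ, -, hβ, hα0, -, hδ0, hsum, he⟩ :=
    exists_comb_regionA h.pos i (h.mem_unitSq r) hA
  rw [h0] at hβ
  obtain rfl : β = 0 := by simpa using hβ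
  exact h.eq_u i r ⟨α, δ, hα0, hδ0, by linarith, by rw [he]; simp⟩

theorem eq_v_of_regionA (h : InvariantLift c σ F g ρ u v) {i : Fin 4} {r : ℝ}
    (hA : g r ∈ regionA c σ i) (h0 : cutForm c σ i (g r) = 0) : g r = g (v i) := by
  obtain ⟨α, β, δ, hα, -, -, hβ0, hδ0, hsum, he⟩ :=
    exists_comb_regionA h.pos i (h.mem_unitSq r) hA
  rw [h0] at hα
  obtain rfl : α = 0 := by simpa using hα
  exact h.eq_v i r ⟨β, δ, hβ0, hδ0, by linarith, by rw [he]; simp⟩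

theorem eq_u_of_regionB (h : InvariantLift c σ F g ρ u v) {i : Fin 4} {r : ℝ}
    (hB : g r ∈ regionB c σ i) (h0 : sideForm c σ (i + 1) (g r) = 0) :
    g r = g (u (i + 1)) := by
  obtain ⟨α, β, δ, -, hδ, hα0, hβ0, -, hsum, he⟩ :=
    exists_comb_regionB h.sq_add_sq h.pos h.lt i hB
  rw [h0] at hδ
  obtain rfl : δ = 0 := by simpa using hδ
  exact h.eq_u (i + 1) r ⟨α, β, hα0, hβ0, by linarith, by rw [he]; simp⟩

theorem eq_v_of_regionB (h : InvariantLift c σ F g ρ u v) {i : Fin 4} {r : ℝ}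
    (hB : g r ∈ regionB c σ i) (h0 : cutForm c σ i (g r) = 0) : g r = g (v i) :=
  h.eq_v_of_regionA ⟨hB.1, h0.ge⟩ h0

theorem side_ne_of_regionB (h : InvariantLift c σ F g ρ u v) {i : Fin 4} {r : ℝ}
    (hB : g r ∈ regionB c σ i) : sideForm c σ i (g r) ≠ 0 := by
  intro h0
  apply h.notMem_Cpiece r
  have hd : 0 < c - σ := sub_pos.2 h.lt
  have e2 := sideForm_add_two c σ i (g r)
  have e3 := sideForm_add_two c σ (i + 1) (g r)
  have h3 : 0 ≤ sideForm c σ (i + 1 + 1 + 1) (g r) := by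
    have hk : cutForm c σ i (g r) = -σ * sideForm c σ (i + 1 + 1 + 1) (g r) := by
      rw [e3]
      unfold sideForm at h0 ⊢
      unfold cutForm
      rw [cycCoord_add_two]
      linear_combination (σ - c) * h0 + cycCoord (i + 1) (g r) * h.sq_add_sq
    by_contra! hneg
    nlinarith [hB.2.1, h.pos]
  apply mem_Cpiece h.sq_add_sq h.lt
  intro j
  rcases Fin.eq_add_of_four i j with rfl | rfl | rfl | rfl
  · exact h0.ge
  · exact hB.2.2
  · rw [e2, h0]; linarith
  · exact h3

/-- Every point of the circle lies in one of the sectors cut out by the side lines. -/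
theorem exists_sector (h : InvariantLift c σ F g ρ u v) (r : ℝ) :
    ∃ i, sideForm c σ i (g r) < 0 ∧ 0 ≤ sideForm c σ (i + 1) (g r) := by
  obtain ⟨i, hi⟩ : ∃ i, sideForm c σ i (g r) < 0 := by
    by_contra! hall
    exact h.notMem_Cpiece r (mem_Cpiece h.sq_add_sq h.lt hall)
  by_cases h1 : 0 ≤ sideForm c σ (i + 1) (g r)
  · exact ⟨i, hi, h1⟩
  · exact ⟨i + 1, not_le.1 h1, by rw [sideForm_add_two]; linarith [h.lt]⟩

theorem side_u (h : InvariantLift c σ F g ρ u v) (i : Fin 4) :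
    sideForm c σ i (g (u i)) = 0 := by
  obtain ⟨j, rfl⟩ : ∃ j, i = j + 1 := ⟨i - 1, by simp⟩
  exact (h.forms_u j).1

theorem side_add_two_u (h : InvariantLift c σ F g ρ u v) (i : Fin 4) :
    0 < sideForm c σ i (g (u (i + 1 + 1))) := by
  have h1 := h.side_u (i + 1 + 1)
  rw [sideForm_add_two] at h1
  linarith [h.lt]

theorem u_mem_regionA (h : InvariantLift c σ F g ρ u v) (i : Fin 4) :
    g (u i) ∈ regionA c σ i := by
  obtain ⟨j, rfl⟩ : ∃ j, i = j + 1 := ⟨i - 1, by simp⟩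
  exact ⟨(h.forms_u j).1.le, (h.forms_u j).2.2.2.le⟩

theorem u_mem_regionB (h : InvariantLift c σ F g ρ u v) (i : Fin 4) :
    g (u (i + 1)) ∈ regionB c σ i :=
  ⟨(h.forms_u i).2.1.le, (h.forms_u i).2.2.1.le, (h.forms_u i).1.ge⟩

theorem v_mem_regionA (h : InvariantLift c σ F g ρ u v) (i : Fin 4) :
    g (v i) ∈ regionA c σ i :=
  ⟨(h.forms_v i).2.1.le, (h.forms_v i).1.ge⟩

theorem v_mem_regionB (h : InvariantLift c σ F g ρ u v) (i : Fin 4) :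
    g (v i) ∈ regionB c σ i :=
  ⟨(h.forms_v i).2.1.le, (h.forms_v i).1.le, (h.forms_v i).2.2.le⟩

theorem add_int (h : InvariantLift c σ F g ρ u v) (r : ℝ) (n : ℤ) : g (r + n) = g r :=
  (h.eq_iff _ _).2 ⟨n, rfl⟩

theorem u_ne_v (h : InvariantLift c σ F g ρ u v) (i j : Fin 4) : g (u i) ≠ g (v j) := by
  intro he
  have hu := h.side_u i
  have h1 := h.forms_u j
  obtain ⟨hc, ha, hb⟩ := h.forms_v j
  have e2 := sideForm_add_two c σ j (g (v j))
  have e3 := sideForm_add_two c σ (j + 1) (g (v j))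
  rcases Fin.eq_add_of_four j i with rfl | rfl | rfl | rfl
  · rw [he] at hu; exact ha.ne hu
  · rw [he] at hu; exact hb.ne' hu
  · rw [he, e2] at hu; linarith [h.lt]
  · have h2 := h.forms_u (j + 1 + 1)
    have e4 : sideForm c σ (j + 1 + 1) (g (v j)) < 0 := he ▸ h2.2.1
    linarith [h.lt]

theorem arc_regionA (h : InvariantLift c σ F g ρ u v) (i : Fin 4) :
    IsArc {r | g r ∈ regionA c σ i} (u i) (v i) :=
  isArc_of_isClosed
    (H := {r | 0 ≤ sideForm c σ i (g r) ∨ cutForm c σ i (g r) ≤ 0})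
    (by
      have h1 := (continuous_sideForm c σ i).comp h.continuous
      have h2 := (continuous_cutForm c σ i).comp h.continuous
      exact (isClosed_le h1 continuous_const).inter (isClosed_le continuous_const h2))
    (by
      have h1 := (continuous_sideForm c σ i).comp h.continuous
      have h2 := (continuous_cutForm c σ i).comp h.continuous
      exact (isClosed_le continuous_const h1).union (isClosed_le h2 continuous_const))
    (fun r => by
      simp only [regionA, mem_ofPred_eq]
      by_contra! hc
      exact absurd (hc.1 hc.2.1.le) (not_lt.2 hc.2.2.le))
    (fun r n => by simp only [mem_ofPred_eq, h.add_int])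
    (by
      rintro r hA (hr | hr)
      · exact Or.inl ((h.eq_iff _ _).1 (h.eq_u_of_regionA hA (le_antisymm hA.1 hr)))
      · exact Or.inr ((h.eq_iff _ _).1 (h.eq_v_of_regionA hA (le_antisymm hr hA.2))))
    (h.u_mem_regionA i) (h.v_mem_regionA i)
    (fun n hn => h.u_ne_v i i ((h.eq_iff _ _).2 ⟨n, hn⟩).symm)
    ⟨u (i + 1 + 1), fun hA => (h.side_add_two_u i).not_ge hA.1⟩

theorem arc_regionB (h : InvariantLift c σ F g ρ u v) (i : Fin 4) :
    IsArc {r | g r ∈ regionB c σ i} (v i) (u (i + 1)) :=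
  isArc_of_isClosed
    (H := {r | 0 ≤ sideForm c σ i (g r) ∨ 0 ≤ cutForm c σ i (g r) ∨
      sideForm c σ (i + 1) (g r) ≤ 0})
    (by
      have h1 := (continuous_sideForm c σ i).comp h.continuous
      have h2 := (continuous_cutForm c σ i).comp h.continuous
      have h3 := (continuous_sideForm c σ (i + 1)).comp h.continuous
      exact (isClosed_le h1 continuous_const).inter
        ((isClosed_le h2 continuous_const).inter (isClosed_le continuous_const h3)))
    (by
      have h1 := (continuous_sideForm c σ i).comp h.continuous
      have h2 := (continuous_cutForm c σ i).comp h.continuous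
      have h3 := (continuous_sideForm c σ (i + 1)).comp h.continuous
      exact (isClosed_le continuous_const h1).union
        ((isClosed_le continuous_const h2).union (isClosed_le h3 continuous_const)))
    (fun r => by
      simp only [regionB, mem_ofPred_eq]
      by_contra! hc
      exact absurd (hc.1 hc.2.1.le hc.2.2.1.le) (not_lt.2 hc.2.2.2.le))
    (fun r n => by simp only [mem_ofPred_eq, h.add_int])
    (by
      rintro r hB (hr | hr | hr)
      · exact (h.side_ne_of_regionB hB (le_antisymm hB.1 hr)).elim
      · exact Or.inl ((h.eq_iff _ _).1 (h.eq_v_of_regionB hB (le_antisymm hB.2.1 hr)))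
      · exact Or.inr ((h.eq_iff _ _).1 (h.eq_u_of_regionB hB (le_antisymm hr hB.2.2))))
    (h.v_mem_regionB i) (h.u_mem_regionB i)
    (fun n hn => h.u_ne_v (i + 1) i ((h.eq_iff _ _).2 ⟨n, hn⟩))
    ⟨u (i + 1 + 1), fun hB => (h.side_add_two_u i).not_ge hB.1⟩

theorem germ_u (h : InvariantLift c σ F g ρ u v) (i : Fin 4) {e : ℝ} (he : e = 1 ∨ e = -1) :
    SideGerm e {r | g r ∈ regionA c σ (i + 1)} (u (i + 1)) ↔
      ¬ SideGerm e {r | g r ∈ regionB c σ i} (u (i + 1)) := by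
  refine sideGerm_iff_not he ?_ ?_ ?_
  · obtain ⟨-, h1, h2, h3⟩ := h.forms_u i
    have c1 := (continuous_sideForm c σ i).comp h.continuous
    have c2 := (continuous_cutForm c σ i).comp h.continuous
    have c3 := (continuous_cutForm c σ (i + 1)).comp h.continuous
    filter_upwards [c1.continuousAt.eventually_lt_const h1,
      c2.continuousAt.eventually_lt_const h2, c3.continuousAt.eventually_const_lt h3]
      with r h1 h2 h3
    rcases le_total (sideForm c σ (i + 1) (g r)) 0 with h0 | h0
    · exact Or.inr ⟨h0, h3.le⟩
    · exact Or.inl ⟨h1.le, h2.le, h0⟩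
  · exact fun r hB hA =>
      (h.eq_iff _ _).1 (h.eq_u_of_regionA hA (le_antisymm hA.1 hB.2.2))
  · rcases he with rfl | rfl
    · exact (h.arc_regionA (i + 1)).right_dich
    · exact (h.arc_regionA (i + 1)).left_dich

theorem germ_v (h : InvariantLift c σ F g ρ u v) (i : Fin 4) {e : ℝ} (he : e = 1 ∨ e = -1) :
    SideGerm e {r | g r ∈ regionB c σ i} (v i) ↔
      ¬ SideGerm e {r | g r ∈ regionA c σ i} (v i) := by
  refine sideGerm_iff_not he ?_ ?_ ?_
  · obtain ⟨-, h1, h2⟩ := h.forms_v i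
    have c1 := (continuous_sideForm c σ i).comp h.continuous
    have c2 := (continuous_sideForm c σ (i + 1)).comp h.continuous
    filter_upwards [c1.continuousAt.eventually_lt_const h1,
      c2.continuousAt.eventually_const_lt h2] with r h1 h2
    rcases le_total (cutForm c σ i (g r)) 0 with h0 | h0
    · exact Or.inr ⟨h1.le, h0, h2.le⟩
    · exact Or.inl ⟨h1.le, h0⟩
  · exact fun r hA hB =>
      (h.eq_iff _ _).1 (h.eq_v_of_regionA hA (le_antisymm hB.2.1 hA.2))
  · rcases he with rfl | rfl
    · exact (h.arc_regionB i).right_dich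
    · exact (h.arc_regionB i).left_dich

/-- The circle runs through the pieces in cyclic order, in a direction recorded by the sign `e`. -/
theorem exists_orientation (h : InvariantLift c σ F g ρ u v) :
    ∃ e : ℝ, (e = 1 ∨ e = -1) ∧ ∀ i,
      SideGerm e {r | g r ∈ regionA c σ (i + 1)} (u (i + 1)) ∧
      SideGerm (-e) {r | g r ∈ regionB c σ i} (u (i + 1)) ∧
      SideGerm e {r | g r ∈ regionB c σ i} (v i) ∧
      SideGerm (-e) {r | g r ∈ regionA c σ i} (v i) := by
  have p1 : (1 : ℝ) = 1 ∨ (1 : ℝ) = -1 := Or.inl rfl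
  have m1 : (-1 : ℝ) = 1 ∨ (-1 : ℝ) = -1 := Or.inr rfl
  have opp : ∀ i, SideGerm (-1) {r | g r ∈ regionA c σ (i + 1)} (u (i + 1)) ↔
      ¬ SideGerm 1 {r | g r ∈ regionA c σ (i + 1)} (u (i + 1)) := by
    refine fun i => ⟨fun hl hr => (h.arc_regionA (i + 1)).not_both ⟨hr, hl⟩, fun hr => ?_⟩
    by_contra hl
    rw [h.germ_u i p1, not_not] at hr
    rw [h.germ_u i m1, not_not] at hl
    exact (h.arc_regionB i).not_both
      ⟨(h.arc_regionB i).right_iff.2 hl, (h.arc_regionB i).left_iff.2 hr⟩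
  have step : ∀ i, SideGerm 1 {r | g r ∈ regionA c σ i} (u i) ↔
      SideGerm 1 {r | g r ∈ regionA c σ (i + 1)} (u (i + 1)) := by
    intro i
    rw [h.germ_u i p1, ← (h.arc_regionB i).left_iff, h.germ_v i m1, not_not,
      (h.arc_regionA i).right_iff]
  have all : ∀ i, SideGerm 1 {r | g r ∈ regionA c σ 0} (u 0) ↔
      SideGerm 1 {r | g r ∈ regionA c σ i} (u i) := by
    have s0 := step 0
    have s1 := step 1
    have s2 := step 2
    simp only [Fin.isValue, zero_add, show (1 : Fin 4) + 1 = 2 from rfl,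
      show (2 : Fin 4) + 1 = 3 from rfl] at s0 s1 s2
    intro i
    fin_cases i
    · exact Iff.rfl
    · exact s0
    · exact s0.trans s1
    · exact (s0.trans s1).trans s2
  by_cases h0 : SideGerm 1 {r | g r ∈ regionA c σ 0} (u 0)
  · refine ⟨1, p1, fun i => ?_⟩
    have hA := (all (i + 1)).1 h0
    have hB : SideGerm (-1) {r | g r ∈ regionB c σ i} (u (i + 1)) := by
      by_contra hB
      exact (opp i).1 ((h.germ_u i m1).2 hB) hA
    exact ⟨hA, hB, (h.arc_regionB i).right_iff.2 hB,
      (h.arc_regionA i).right_iff.1 ((all i).1 h0)⟩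
  · refine ⟨-1, m1, fun i => ?_⟩
    rw [neg_neg]
    have hA := (opp i).2 (mt (all (i + 1)).2 h0)
    have hB : SideGerm 1 {r | g r ∈ regionB c σ i} (u (i + 1)) := by
      by_contra hB
      exact h0 ((all (i + 1)).2 ((h.germ_u i p1).2 hB))
    have hA' : SideGerm (-1) {r | g r ∈ regionA c σ i} (u i) := by
      obtain ⟨j, rfl⟩ : ∃ j, i = j + 1 := ⟨i - 1, by simp⟩
      exact (opp j).2 (mt (all (j + 1)).2 h0)
    exact ⟨hA, hB, (h.arc_regionB i).left_iff.2 hB, (h.arc_regionA i).left_iff.1 hA'⟩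

/-- Signed area of the triangle spanned by `g r` and two close points of the circle on its
two sides. -/
def localArea (g : ℝ → Pt) (e r ε : ℝ) : ℝ := crossAt (g r) (g (r + -e * ε)) (g (r + e * ε))

theorem localArea_add_int (h : InvariantLift c σ F g ρ u v) (e r ε : ℝ) (n : ℤ) :
    localArea g e (r + n) ε = localArea g e r ε := by
  unfold localArea
  rw [h.add_int, add_right_comm, h.add_int, add_right_comm, h.add_int]

theorem localArea_add (h : InvariantLift c σ F g ρ u v) (e r ε : ℝ) :
    localArea g e (r + ρ) ε =
      crossAt (F (g r)) (F (g (r + -e * ε))) (F (g (r + e * ε))) := by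
  unfold localArea
  rw [h.conj, h.conj, h.conj, add_right_comm, add_right_comm r ρ]

theorem localArea_lt_u (h : InvariantLift c σ F g ρ u v) {e : ℝ} (he : e = 1 ∨ e = -1)
    (i : Fin 4) (hA : SideGerm e {r | g r ∈ regionA c σ (i + 1)} (u (i + 1)))
    (hB : SideGerm (-e) {r | g r ∈ regionB c σ i} (u (i + 1))) :
    ∀ᶠ ε in nhdsWithin (0 : ℝ) (Ioi 0),
      localArea g e (u (i + 1)) ε < localArea g e (u (i + 1) + ρ) ε := by
  filter_upwards [hA, hB, Ioo_mem_nhdsGT (zero_lt_one' ℝ)] with ε h1 h2 h3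
  have he' : -e = 1 ∨ -e = -1 := by rcases he with rfl | rfl <;> simp
  rw [h.localArea_add]
  refine crossAt_lt_of_side h.sq_add_sq h.pos h.lt h.isPAMap i (h.mem_unitSq _) (h.mem_unitSq _)
    h2 h1 (h.u_mem_regionA _) (fun h0 => ?_) (fun h0 => ?_) (h.side_u _)
  · obtain ⟨n, hn⟩ := (h.eq_iff _ _).1 (h.eq_u_of_regionB h2 h0)
    exact add_mul_ne_add_int he' h3.1 h3.2 _ n hn
  · obtain ⟨n, hn⟩ := (h.eq_iff _ _).1 (h.eq_u_of_regionA h1 h0)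
    exact add_mul_ne_add_int he h3.1 h3.2 _ n hn

theorem localArea_lt_v (h : InvariantLift c σ F g ρ u v) {e : ℝ} (he : e = 1 ∨ e = -1)
    (i : Fin 4) (hB : SideGerm e {r | g r ∈ regionB c σ i} (v i))
    (hA : SideGerm (-e) {r | g r ∈ regionA c σ i} (v i)) :
    ∀ᶠ ε in nhdsWithin (0 : ℝ) (Ioi 0),
      localArea g e (v i + ρ) ε < localArea g e (v i) ε := by
  filter_upwards [hA, hB, Ioo_mem_nhdsGT (zero_lt_one' ℝ)] with ε h1 h2 h3
  have he' : -e = 1 ∨ -e = -1 := by rcases he with rfl | rfl <;> simp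
  rw [h.localArea_add]
  refine crossAt_lt_of_cut h.sq_add_sq h.pos h.lt h.isPAMap i (h.mem_unitSq _) (h.mem_unitSq _)
    h1 h2 (h.v_mem_regionA _) (fun h0 => ?_) (fun h0 => ?_) (h.forms_v i).1
  · obtain ⟨n, hn⟩ := (h.eq_iff _ _).1 (h.eq_v_of_regionA h1 h0)
    exact add_mul_ne_add_int he' h3.1 h3.2 _ n hn
  · obtain ⟨n, hn⟩ := (h.eq_iff _ _).1 (h.eq_v_of_regionB h2 h0)
    exact add_mul_ne_add_int he h3.1 h3.2 _ n hn

/-- Off the break points, the circle stays near each of its points in one piece. -/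
theorem eventually_mem_region (h : InvariantLift c σ F g ρ u v) {r : ℝ}
    (hu : ∀ j, g r ≠ g (u j)) (hv : ∀ j, g r ≠ g (v j)) :
    ∃ i, (∀ᶠ x in nhds r, g x ∈ regionA c σ i) ∨ ∀ᶠ x in nhds r, g x ∈ regionB c σ i := by
  obtain ⟨i, h1, h2⟩ := h.exists_sector r
  have hc : 0 < c := h.pos.trans h.lt
  have h2' : 0 < sideForm c σ (i + 1) (g r) := by
    refine h2.lt_of_ne fun h0 => hu (i + 1) (h.eq_u_of_regionB ⟨h1.le, ?_, h2⟩ h0.symm)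
    have hX := cycCoord_nonneg (h.mem_unitSq r) (i + 1)
    have hk : c * cutForm c σ i (g r) = -((c - σ) * cycCoord (i + 1) (g r)) := by
      unfold sideForm at h0
      unfold cutForm
      rw [cycCoord_add_two] at h0
      linear_combination -σ ^ 2 * h0 + cycCoord (i + 1) (g r) * σ * h.sq_add_sq
    have hm := mul_nonneg (sub_nonneg.2 h.lt.le) hX
    by_contra! hpos
    linarith [mul_pos hc hpos]
  have c1 := (continuous_sideForm c σ i).comp h.continuous
  have c2 := (continuous_sideForm c σ (i + 1)).comp h.continuous
  have c3 := (continuous_cutForm c σ i).comp h.continuous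
  refine ⟨i, ?_⟩
  rcases lt_trichotomy (cutForm c σ i (g r)) 0 with h3 | h3 | h3
  · right
    filter_upwards [c1.continuousAt.eventually_lt_const h1,
      c2.continuousAt.eventually_const_lt h2', c3.continuousAt.eventually_lt_const h3]
      with x h1 h2 h3
    exact ⟨h1.le, h3.le, h2.le⟩
  · exact (hv i (h.eq_v_of_regionA ⟨h1.le, h3.ge⟩ h3)).elim
  · left
    filter_upwards [c1.continuousAt.eventually_lt_const h1,
      c3.continuousAt.eventually_const_lt h3] with x h1 h3
    exact ⟨h1.le, h3.le⟩

theorem localArea_eq (h : InvariantLift c σ F g ρ u v) (e : ℝ) {r : ℝ}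
    (hu : ∀ j, g r ≠ g (u j)) (hv : ∀ j, g r ≠ g (v j)) :
    ∀ᶠ ε in nhdsWithin (0 : ℝ) (Ioi 0), localArea g e (r + ρ) ε = localArea g e r ε := by
  obtain ⟨i, hi | hi⟩ := h.eventually_mem_region hu hv
  · filter_upwards [sideGerm_of_nhds hi e, sideGerm_of_nhds hi (-e)] with ε h1 h2
    rw [h.localArea_add]
    exact crossAt_map_regionA h.pos h.isPAMap i (h.mem_unitSq _) (h.mem_unitSq _)
      (h.mem_unitSq _) h2 h1 hi.self_of_nhds
  · filter_upwards [sideGerm_of_nhds hi e, sideGerm_of_nhds hi (-e)] with ε h1 h2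
    rw [h.localArea_add]
    exact crossAt_map_regionB h.sq_add_sq h.pos h.lt h.isPAMap i h2 h1 hi.self_of_nhds

theorem exists_orbit (h : InvariantLift c σ F g ρ u v) {q : ℕ} (hq : 1 ≤ q) {p : ℤ}
    (hρ : q * ρ = p) :
    (∀ i, ∃ (j : Fin 4) (n : ℕ), 1 ≤ n ∧ g (u i + n * ρ) = g (v j)) ∧
    ∀ j, ∃ (i : Fin 4) (n : ℕ), 1 ≤ n ∧ g (v j + n * ρ) = g (u i) := by
  obtain ⟨e, he, ho⟩ := h.exists_orientation
  have hU : ∀ r j, g r = g (u j) → ∀ᶠ ε in nhdsWithin (0 : ℝ) (Ioi 0),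
      localArea g e r ε < localArea g e (r + ρ) ε := by
    intro r j hr
    obtain ⟨i, rfl⟩ : ∃ i, j = i + 1 := ⟨j - 1, by simp⟩
    obtain ⟨n, rfl⟩ := (h.eq_iff _ _).1 hr
    simp_rw [add_right_comm _ (n : ℝ) ρ, h.localArea_add_int]
    exact h.localArea_lt_u he i (ho i).1 (ho i).2.1
  have hV : ∀ r i, g r = g (v i) → ∀ᶠ ε in nhdsWithin (0 : ℝ) (Ioi 0),
      localArea g e (r + ρ) ε < localArea g e r ε := by
    intro r i hr
    obtain ⟨n, rfl⟩ := (h.eq_iff _ _).1 hr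
    simp_rw [add_right_comm _ (n : ℝ) ρ, h.localArea_add_int]
    exact h.localArea_lt_v he i (ho i).2.2.1 (ho i).2.2.2
  constructor
  · intro i
    obtain ⟨n, hn, j, hj⟩ := exists_mem_of_periodic_increase (a := localArea g e)
      (T := {r | ∃ j, g r = g (v j)}) hq (r := u i)
      (fun ε => by rw [hρ, h.localArea_add_int]) (hU _ i rfl) (fun x hx => by
        by_cases hxu : ∃ j, g x = g (u j)
        · exact (hU x _ hxu.choose_spec).mono fun _ hε => hε.le
        · exact (h.localArea_eq e (not_exists.1 hxu) (not_exists.1 hx)).mono fun _ hε => hε.ge)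
    exact ⟨j, n, hn, hj⟩
  · intro i
    obtain ⟨n, hn, j, hj⟩ := exists_mem_of_periodic_increase
      (a := fun r ε => -localArea g e r ε)
      (T := {r | ∃ j, g r = g (u j)}) hq (r := v i)
      (fun ε => by rw [hρ, h.localArea_add_int])
      ((hV _ i rfl).mono fun _ hε => neg_lt_neg hε) (fun x hx => by
        by_cases hxv : ∃ j, g x = g (v j)
        · exact (hV x _ hxv.choose_spec).mono fun _ hε => neg_le_neg hε.le
        · exact (h.localArea_eq e (not_exists.1 hx) (not_exists.1 hxv)).mono
            fun _ hε => neg_le_neg hε.le)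
    exact ⟨j, n, hn, hj⟩

end InvariantLift

/-- A point of `[Eᵢ, Pⱼ]` fixed by `F` is the corner, since `F` moves `Pⱼ`. -/
theorem eq_Ept_of_fixed {s t : ℝ} (hs : s ≠ 1 / 2) {F : Pt → Pt} (hF : IsPAMap s t F)
    {i j : Fin 4} (hij : i = j ∨ i = j + 1) {x : Pt} (hx : x ∈ segment ℝ (Ept i) (Ppt s t j))
    (hfix : F x = x) : x = Ept i := by
  obtain ⟨-, -, hFA, -, -, hFE, hFP⟩ := hF
  obtain ⟨f, hf⟩ := hFA j
  obtain ⟨a, b, ha, hb, hab, rfl⟩ := hx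
  have hne : Ppt' s t j - Ppt s t j ≠ 0 := by
    intro h0
    fin_cases j <;> simp [Ppt, Ppt', Prod.ext_iff] at h0 <;> exact hs (by linarith)
  have hE : Ept i ∈ Apiece s t j := subset_convexHull _ _ (by rcases hij with rfl | rfl <;> simp)
  have hP : Ppt s t j ∈ Apiece s t j := subset_convexHull _ _ (by simp)
  have hm : a • Ept i + b • Ppt s t j ∈ Apiece s t j :=
    convex_convexHull ℝ _ hE hP ha hb hab
  have key : F (a • Ept i + b • Ppt s t j) = a • Ept i + b • Ppt' s t j := by
    rw [hf hm, Convex.combo_affine_apply hab, ← hf hE, ← hf hP, hFE, hFP]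
  rw [key] at hfix
  have h0 : b • (Ppt' s t j - Ppt s t j) = 0 := by
    rw [smul_sub, sub_eq_zero]
    exact add_left_cancel hfix
  obtain rfl : b = 0 := (smul_eq_zero.1 h0).resolve_right hne
  obtain rfl : a = 1 := by linarith
  simp

/-- Let `Γ` be a rotationally symmetric invariant circle for `F`,
disjoint from `𝒞`, on which `F` is conjugate (via a parametrisation `γ : ℝ/ℤ → Q`)
to the rational rotation by `p/q`, and which meets each break segment `[Eᵢ,Pᵢ]` in a
single point `Uᵢ` and each break segment `[Eᵢ₊₁,Pᵢ]` in a single point `Vᵢ`. Then the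
forward orbit of each `Uᵢ` contains some `Vⱼ`, and the forward orbit of each `Vⱼ`
contains some `Uᵢ`. -/
theorem cancellation_orbits_periodic_case (θ : ℝ) (hθ : θ ∈ Ioo 0 (π/4))
    (t s : ℝ) (ht : t = sin θ ^ 2) (hs : s = sin θ * cos θ)
    (F : Pt → Pt) (hF : IsPAMap s t F)
    (γ : AddCircle (1:ℝ) → Pt) (hγcont : Continuous γ) (hγinj : Function.Injective γ)
    (Γ : Set Pt) (hΓ : Γ = range γ) (hΓQ : Γ ⊆ unitSq)
    (hFinv : F '' Γ = Γ) (hdisjC : Γ ∩ Cpiece s t = ∅)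
    (hRinv : Rmap '' Γ = Γ)
    (p q : ℕ) (hq : 1 ≤ q) (hcop : Nat.Coprime p q)
    (hconj : ∀ x : AddCircle (1:ℝ), F (γ x) = γ (x + (((p : ℝ)/(q : ℝ) : ℝ) : AddCircle (1:ℝ))))
    (U V : Fin 4 → Pt)
    (hU : ∀ i : Fin 4, Γ ∩ segment ℝ (Ept i) (Ppt s t i) = {U i})
    (hV : ∀ i : Fin 4, Γ ∩ segment ℝ (Ept (i+1)) (Ppt s t i) = {V i}) :
    (∀ i : Fin 4, ∃ (j : Fin 4) (n : ℕ), 1 ≤ n ∧ F^[n] (U i) = V j) ∧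
    (∀ j : Fin 4, ∃ (i : Fin 4) (n : ℕ), 1 ≤ n ∧ F^[n] (V j) = U i) := by
  obtain ⟨hθ0, hθ4⟩ := hθ
  have hσ : 0 < sin θ := sin_pos_of_pos_of_lt_pi hθ0 (by linarith [pi_pos])
  have hlt : sin θ < cos θ := by
    rw [← cos_pi_div_two_sub]
    exact cos_lt_cos_of_nonneg_of_le_pi hθ0.le (by linarith) (by linarith)
  have hcσ : cos θ ^ 2 + sin θ ^ 2 = 1 := cos_sq_add_sin_sq θ
  subst ht hs hΓ
  have hUm : ∀ i, U i ∈ range γ ∩ segment ℝ (Ept i) (Ppt (sin θ * cos θ) (sin θ ^ 2) i) :=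
    fun i => by rw [hU i]; rfl
  have hVm : ∀ i,
      V i ∈ range γ ∩ segment ℝ (Ept (i + 1)) (Ppt (sin θ * cos θ) (sin θ ^ 2) i) :=
    fun i => by rw [hV i]; rfl
  by_cases hfix : ∃ x : AddCircle (1 : ℝ), F (γ x) = γ x
  · obtain ⟨x, hx⟩ := hfix
    have h0 : (((p : ℝ) / (q : ℝ) : ℝ) : AddCircle (1 : ℝ)) = 0 := by
      rw [hconj] at hx
      exact add_eq_left.1 (hγinj hx)
    have hall : ∀ y ∈ range γ, F y = y := by
      rintro _ ⟨y, rfl⟩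
      rw [hconj, h0, add_zero]
    have hs2 : sin θ * cos θ ≠ 1 / 2 := fun hs2 => by
      nlinarith [mul_pos (sub_pos.2 hlt) (sub_pos.2 hlt)]
    have hUE : ∀ i, U i = Ept i := fun i =>
      eq_Ept_of_fixed hs2 hF (Or.inl rfl) (hUm i).2 (hall _ (hUm i).1)
    have hVE : ∀ i, V i = Ept (i + 1) := fun i =>
      eq_Ept_of_fixed hs2 hF (Or.inr rfl) (hVm i).2 (hall _ (hVm i).1)
    refine ⟨fun i => ⟨i - 1, 1, le_rfl, ?_⟩, fun j => ⟨j + 1, 1, le_rfl, ?_⟩⟩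
    · rw [Function.iterate_one, hall _ (hUm i).1, hUE, hVE, sub_add_cancel]
    · rw [Function.iterate_one, hall _ (hVm j).1, hUE, hVE]
  · push Not at hfix
    have hul : ∀ i, ∃ r : ℝ, γ r = U i := fun i => by
      obtain ⟨x, hx⟩ := (hUm i).1
      obtain ⟨r, rfl⟩ := QuotientAddGroup.mk_surjective x
      exact ⟨r, hx⟩
    have hvl : ∀ i, ∃ r : ℝ, γ r = V i := fun i => by
      obtain ⟨x, hx⟩ := (hVm i).1
      obtain ⟨r, rfl⟩ := QuotientAddGroup.mk_surjective x
      exact ⟨r, hx⟩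
    choose u hu using hul
    choose v hv using hvl
    have h : InvariantLift (cos θ) (sin θ) F (fun r : ℝ => γ r) ((p : ℝ) / q) u v :=
      { sq_add_sq := hcσ
        pos := hσ
        lt := hlt
        isPAMap := hF
        continuous := hγcont.comp (AddCircle.continuous_mk' 1)
        eq_iff := fun r r' => by
          rw [hγinj.eq_iff, ← sub_eq_zero, ← AddCircle.coe_sub, AddCircle.coe_eq_zero_iff]
          refine exists_congr fun n => ?_
          rw [zsmul_eq_mul, mul_one, eq_sub_iff_add_eq', eq_comm]
        mem_unitSq := fun r => hΓQ ⟨_, rfl⟩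
        notMem_Cpiece := fun r hr => by
          have : γ r ∈ range γ ∩ Cpiece (sin θ * cos θ) (sin θ ^ 2) := ⟨⟨_, rfl⟩, hr⟩
          rw [hdisjC] at this
          exact this
        ne_Ept := fun r i hr => hfix r (by rw [hr]; exact hF.2.2.2.2.2.1 i)
        conj := fun r => by rw [hconj, ← AddCircle.coe_add]
        mem_u := fun i => by rw [hu]; exact (hUm i).2
        eq_u := fun i r hr => by
          have : γ r ∈ ({U i} : Set Pt) := hU i ▸ ⟨⟨_, rfl⟩, hr⟩
          rw [hu]; exact this
        mem_v := fun i => by rw [hv]; exact (hVm i).2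
        eq_v := fun i r hr => by
          have : γ r ∈ ({V i} : Set Pt) := hV i ▸ ⟨⟨_, rfl⟩, hr⟩
          rw [hv]; exact this }
    have hq0 : (q : ℝ) ≠ 0 := by positivity
    have hρ : (q : ℝ) * ((p : ℝ) / q) = ((p : ℤ) : ℝ) := by
      rw [mul_div_cancel₀ _ hq0, Int.cast_natCast]
    have hiter : ∀ (r : ℝ) (n : ℕ), F^[n] (γ r) = γ ((r + n * ((p : ℝ) / q) : ℝ)) := by
      intro r n
      induction n with
      | zero => simp
      | succ n ih =>
        rw [Function.iterate_succ_apply', ih, h.conj]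
        congr 2
        push_cast
        ring
    obtain ⟨H1, H2⟩ := h.exists_orbit hq hρ
    refine ⟨fun i => ?_, fun j => ?_⟩
    · obtain ⟨j, n, hn, hj⟩ := H1 i
      exact ⟨j, n, hn, by rw [← hu, ← hv, hiter]; exact hj⟩
    · obtain ⟨i, n, hn, hi⟩ := H2 j
      exact ⟨i, n, hn, by rw [← hu, ← hv, hiter]; exact hi⟩
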